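/- Let G be a connected finite simple graph on n vertices with m edges and connected domination number γ_c(G) = k, let D_c be a minimum connected dominating set of G, and let ξ = |det A_{D_c}(G)| be the absolute value of the determinant of the c-dominating matrix. Then E_{D_c}(G) ≥ √(2m + k + n(n−1)·ξ^{2/n}). -/

import Mathlib

open Finset Matrix

set_option linter.unusedSectionVars false

variable {V : Type*} [Fintype V] [DecidableEq V]

/-- `D` is a dominating set of `G`: every vertex is in `D` or adjacent to a vertex of `D`. -/
def IsDominatingSet (G : SimpleGraph V) (D : Finset V) : Prop :=
  ∀ v : V, v ∈ D ∨ ∃ u ∈ D, G.Adj u v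

/-- `D` is a connected dominating set: a dominating set inducing a connected subgraph. -/
def IsConnectedDominatingSet (G : SimpleGraph V) (D : Finset V) : Prop :=
  IsDominatingSet G D ∧ (G.induce (D : Set V)).Connected

/-- `D` is a minimum dominating set of `G`. -/
def IsMinimumDominatingSet (G : SimpleGraph V) (D : Finset V) : Prop :=
  IsDominatingSet G D ∧ ∀ D' : Finset V, IsDominatingSet G D' → D.card ≤ D'.card

/-- `D` is a minimum connected dominating set of `G`. -/
def IsMinimumConnectedDominatingSet (G : SimpleGraph V) (D : Finset V) : Prop :=
  IsConnectedDominatingSet G D ∧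
    ∀ D' : Finset V, IsConnectedDominatingSet G D' → D.card ≤ D'.card

/-- The (minimum/connected) dominating matrix of `G` w.r.t. a set `D`:
entry `(i,j)` is `1` if `i` is adjacent to `j`, `1` if `i = j ∈ D`, and `0` otherwise. -/
def domMatrix (G : SimpleGraph V) [DecidableRel G.Adj] (D : Finset V) : Matrix V V ℝ :=
  Matrix.of fun i j =>
    if i = j then (if i ∈ D then 1 else 0) else (if G.Adj i j then 1 else 0)

theorem domMatrix_isHermitian (G : SimpleGraph V) [DecidableRel G.Adj] (D : Finset V) :
    (domMatrix G D).IsHermitian := by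
  show (domMatrix G D)ᴴ = domMatrix G D
  ext i j
  simp only [Matrix.conjTranspose_apply, domMatrix, Matrix.of_apply, star_trivial]
  rcases eq_or_ne i j with rfl | h
  · simp
  · rw [if_neg (Ne.symm h), if_neg h]
    simp only [G.adj_comm j i]

/-- The eigenvalues of the dominating matrix (real, since the matrix is symmetric). -/
noncomputable def domEigen (G : SimpleGraph V) [DecidableRel G.Adj] (D : Finset V) : V → ℝ :=
  (domMatrix_isHermitian G D).eigenvalues

/-- The (c-)dominating energy: the sum of the absolute values of the eigenvalues
of the dominating matrix. -/
noncomputable def domEnergy (G : SimpleGraph V) [DecidableRel G.Adj] (D : Finset V) : ℝ :=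
  ∑ i, |domEigen G D i|

/-- A support vertex: a vertex adjacent to a pendant vertex (a vertex of degree 1). -/
def IsSupportVertex (G : SimpleGraph V) [DecidableRel G.Adj] (v : V) : Prop :=
  ∃ u, G.Adj v u ∧ G.degree u = 1

/-- The trace of the square of a real symmetric matrix is the sum of its squared eigenvalues. -/
theorem Matrix.IsHermitian.trace_mul_self_eq_sum_sq_eigenvalues {A : Matrix V V ℝ}
    (hA : A.IsHermitian) : (A * A).trace = ∑ i, hA.eigenvalues i ^ 2 := by
  conv_lhs => rw [hA.spectral_theorem]
  rw [← map_mul, Unitary.conjStarAlgAut_apply, Matrix.trace_mul_cycle, Unitary.coe_star_mul_self,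
    one_mul, Matrix.diagonal_mul_diagonal, Matrix.trace_diagonal]
  simp [pow_two]

/-- The trace of the square of the dominating matrix. -/
theorem trace_domMatrix_mul_self (G : SimpleGraph V) [DecidableRel G.Adj] (D : Finset V) :
    (domMatrix G D * domMatrix G D).trace = 2 * (G.edgeFinset.card : ℝ) + D.card := by
  have hentry (i j : V) : domMatrix G D i j * domMatrix G D j i =
      (if G.Adj i j then 1 else 0) + (if i = j then (if i ∈ D then 1 else 0) else 0) := by
    rcases eq_or_ne i j with rfl | h
    · simp [domMatrix]
    · simp [domMatrix, h, h.symm, G.adj_comm j i]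
  have hdeg : ∑ v, (G.degree v : ℝ) = 2 * (G.edgeFinset.card : ℝ) := by
    exact_mod_cast G.sum_degrees_eq_twice_card_edges
  simp [Matrix.trace, Matrix.mul_apply, hentry, Finset.sum_add_distrib, ← hdeg,
    ← G.card_neighborFinset_eq_degree, G.neighborFinset_eq_filter]

theorem Finset.prod_offDiag_mul {ι M : Type*} [Fintype ι] [DecidableEq ι] [CommMonoid M]
    (x : ι → M) :
    ∏ p ∈ (univ : Finset ι).offDiag, x p.1 * x p.2 =
      (∏ i, x i) ^ (2 * (Fintype.card ι - 1)) := by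
  have hfst : ∏ p ∈ (univ : Finset ι).offDiag, x p.1 = (∏ i, x i) ^ (Fintype.card ι - 1) := by
    rw [Finset.prod_finset_product _ univ (fun i => univ.erase i) (by simp [ne_comm])]
    simp [Finset.card_erase_of_mem, Finset.prod_pow]
  have hsnd : ∏ p ∈ (univ : Finset ι).offDiag, x p.2 = (∏ i, x i) ^ (Fintype.card ι - 1) := by
    rw [Finset.prod_finset_product_right _ univ (fun i => univ.erase i) (by simp)]
    simp [Finset.card_erase_of_mem, Finset.prod_pow]
  rw [Finset.prod_mul_distrib, hfst, hsnd, two_mul, pow_add]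

theorem Finset.sq_sum_eq_sum_sq_add_sum_offDiag {ι R : Type*} [Fintype ι] [DecidableEq ι]
    [CommSemiring R] (x : ι → R) :
    (∑ i, x i) ^ 2 = ∑ i, x i ^ 2 + ∑ p ∈ (univ : Finset ι).offDiag, x p.1 * x p.2 := by
  rw [pow_two, Finset.sum_mul_sum, ← Finset.sum_product', ← Finset.diag_union_offDiag,
    Finset.sum_union (Finset.disjoint_diag_offDiag _), Finset.sum_diag]
  simp only [pow_two]

/-- The AM-GM inequality for the products of pairs of distinct terms. -/
theorem Real.card_mul_prod_rpow_le_sum_offDiag {ι : Type*} [Fintype ι] [DecidableEq ι]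
    (x : ι → ℝ) (hx : ∀ i, 0 ≤ x i) :
    (Fintype.card ι : ℝ) * ((Fintype.card ι : ℝ) - 1) *
        (∏ i, x i) ^ ((2 : ℝ) / (Fintype.card ι : ℝ)) ≤
      ∑ p ∈ (univ : Finset ι).offDiag, x p.1 * x p.2 := by
  have hnonneg (p : ι × ι) : 0 ≤ x p.1 * x p.2 := mul_nonneg (hx _) (hx _)
  rcases le_or_gt (Fintype.card ι) 1 with h | h
  · have hzero : (Fintype.card ι : ℝ) * ((Fintype.card ι : ℝ) - 1) = 0 := by
      interval_cases Fintype.card ι <;> simp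
    rw [hzero, zero_mul]
    exact Finset.sum_nonneg fun p _ => hnonneg p
  · have hn : (1 : ℝ) < Fintype.card ι := by exact_mod_cast h
    have hcard : (((univ : Finset ι).offDiag.card : ℕ) : ℝ) =
        (Fintype.card ι : ℝ) * ((Fintype.card ι : ℝ) - 1) := by
      rw [Finset.offDiag_card, Finset.card_univ, Nat.cast_sub (Nat.le_mul_self _)]
      push_cast
      ring
    have hpos : (0 : ℝ) < (Fintype.card ι : ℝ) * ((Fintype.card ι : ℝ) - 1) :=
      mul_pos (by linarith) (by linarith)
    have hamgm := Real.geom_mean_le_arith_mean (univ : Finset ι).offDiag (fun _ => 1)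
      (fun p => x p.1 * x p.2) (by simp)
      (by rwa [Finset.sum_const, nsmul_eq_mul, hcard, mul_one]) (fun p _ => hnonneg p)
    simp only [Real.rpow_one, one_mul, Finset.sum_const, nsmul_eq_mul, mul_one, hcard,
      Finset.prod_offDiag_mul] at hamgm
    have hexp : ((2 * (Fintype.card ι - 1) : ℕ) : ℝ) *
        ((Fintype.card ι : ℝ) * ((Fintype.card ι : ℝ) - 1))⁻¹ = 2 / (Fintype.card ι : ℝ) := by
      have hne : (Fintype.card ι : ℝ) - 1 ≠ 0 := by linarith
      push_cast [Nat.cast_sub h.le]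
      field_simp
    rw [← Real.rpow_natCast_mul (Finset.prod_nonneg fun i _ => hx i), hexp,
      le_div_iff₀ hpos] at hamgm
    linarith

/-- Determinant lower bound: with `ξ = |det A_{D_c}(G)|`,
`E_{D_c}(G) ≥ √(2m + k + n(n−1)·ξ^(2/n))`. -/
theorem cDomEnergy_ge_det_bound (n m k : ℕ)
    (G : SimpleGraph (Fin n)) [DecidableRel G.Adj]
    (hconn : G.Connected) (hm : G.edgeFinset.card = m)
    (Dc : Finset (Fin n)) (hDc : IsMinimumConnectedDominatingSet G Dc) (hk : Dc.card = k) :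
    Real.sqrt (2 * (m : ℝ) + (k : ℝ) +
        (n : ℝ) * ((n : ℝ) - 1) * |(domMatrix G Dc).det| ^ ((2 : ℝ) / (n : ℝ)))
      ≤ domEnergy G Dc := by
  have htrace : ∑ i, |domEigen G Dc i| ^ 2 = 2 * (m : ℝ) + k := by
    simp only [sq_abs, domEigen]
    rw [← (domMatrix_isHermitian G Dc).trace_mul_self_eq_sum_sq_eigenvalues,
      trace_domMatrix_mul_self, hm, hk]
  have hdet : |(domMatrix G Dc).det| = ∏ i, |domEigen G Dc i| := by
    rw [(domMatrix_isHermitian G Dc).det_eq_prod_eigenvalues, Finset.abs_prod]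
    rfl
  have hpairs := Real.card_mul_prod_rpow_le_sum_offDiag (fun i => |domEigen G Dc i|)
    fun i => abs_nonneg _
  rw [Fintype.card_fin] at hpairs
  refine Real.sqrt_le_iff.mpr ⟨Finset.sum_nonneg fun i _ => abs_nonneg _, ?_⟩
  rw [domEnergy, Finset.sq_sum_eq_sum_sq_add_sum_offDiag, htrace, hdet]
  gcongr
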